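/- Let E be a Banach space, F a Hilbert space with Besselian and Hilbertian basis (b_i), and F = { x ∈ E : g_i(x) = 0 for i ∈ I₀ } the feasible set of the purely equality-constrained problem (I₁ = ∅), where g_i = b_i* ∘ G for a C¹ mapping G : E → F. Let x₀ ∈ F be a local minimizer of a Fréchet differentiable objective f₀ on F, and assume CRC+ holds for (g_i)_{i∈I₀} at x₀. Then there exists λ ∈ F such that Df₀(x₀) = λ ∘ DG(x₀), i.e., a Lagrange multiplier exists at x₀. -/

import Mathlib

open Filter Topology Set

section Defs

variable {X : Type*} [NormedAddCommGroup X] [NormedSpace ℝ X]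

/-- Partial sums of a series `∑_{n ∈ J} a n • v n`, summed in the natural order of `ℕ`. -/
noncomputable def partialSumOn (J : Set ℕ) (a : ℕ → ℝ) (v : ℕ → X) (N : ℕ) : X :=
  ∑ n ∈ Finset.range N, J.indicator a n • v n

/-- The series `∑_{n ∈ J} a n • v n` converges to `x`. -/
def ConvergesOn (J : Set ℕ) (a : ℕ → ℝ) (v : ℕ → X) (x : X) : Prop :=
  Tendsto (partialSumOn J a v) atTop (𝓝 x)

/-- `(v i)_{i ∈ J}` is a Schauder basis (basic family) for the set `S`. -/
def IsSchauderBasisOn (J : Set ℕ) (v : ℕ → X) (S : Set X) : Prop :=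
  ∀ x ∈ S, ∃! a : ℕ → ℝ, (∀ n ∉ J, a n = 0) ∧ ConvergesOn J a v x

/-- `(v n)` is a Schauder basis of the whole space. -/
def IsSchauderBasis (v : ℕ → X) : Prop :=
  ∀ x : X, ∃! a : ℕ → ℝ,
    Tendsto (fun N => ∑ n ∈ Finset.range N, a n • v n) atTop (𝓝 x)

/-- Boundedly-complete family: bounded partial sums imply convergence. -/
def BoundedlyCompleteOn (J : Set ℕ) (v : ℕ → X) : Prop :=
  ∀ a : ℕ → ℝ, (∃ C : ℝ, ∀ N, ‖partialSumOn J a v N‖ ≤ C) →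
    ∃ x, ConvergesOn J a v x

/-- Besselian family: convergence of `∑ a n • v n` forces square-summability. -/
def BesselianOn (J : Set ℕ) (v : ℕ → X) : Prop :=
  ∀ a : ℕ → ℝ, (∀ n ∉ J, a n = 0) → (∃ x, ConvergesOn J a v x) →
    Summable (fun n => (a n) ^ 2)

/-- Hilbertian family: square-summability forces convergence of `∑ a n • v n`. -/
def HilbertianOn (J : Set ℕ) (v : ℕ → X) : Prop :=
  ∀ a : ℕ → ℝ, (∀ n ∉ J, a n = 0) → Summable (fun n => (a n) ^ 2) →
    ∃ x, ConvergesOn J a v x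

/-- The Bouligand (contingent) tangent cone to `Q` at `y`. -/
def bouligandTangentCone (Q : Set X) (y : X) : Set X :=
  {d | ∃ (yk : ℕ → X) (tk : ℕ → ℝ), (∀ k, yk k ∈ Q) ∧ (∀ k, 0 < tk k) ∧
     Tendsto tk atTop (𝓝 0) ∧ Tendsto yk atTop (𝓝 y) ∧
     Tendsto (fun k => (tk k)⁻¹ • (yk k - y)) atTop (𝓝 d)}

/-- Shrinking family: the biorthogonal functionals form a basis of the dual of the closed span. -/
def ShrinkingOn (J₁ J₂ : Set ℕ) (v : ℕ → X) : Prop :=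
  ∃ vs : ℕ → (↥((Submodule.span ℝ (v '' J₁)).topologicalClosure) →L[ℝ] ℝ),
    (∀ i ∈ J₂, ∀ j ∈ J₂,
        ∀ h : v j ∈ (Submodule.span ℝ (v '' J₁)).topologicalClosure,
        vs i ⟨v j, h⟩ = if i = j then 1 else 0) ∧
    IsSchauderBasisOn J₂ vs Set.univ

end Defs

section CRC

variable {E F : Type*} [NormedAddCommGroup E] [NormedSpace ℝ E]
  [NormedAddCommGroup F] [NormedSpace ℝ F]

/-- The Constant Rank Condition Plus for the family `(f_i)_{i ∈ J₁}` at `x₀`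
with basic index set `J₂` and neighbourhood `V`, where `b` is the basis of the
target space and `w j` represents the biorthogonal functional `Df_j(x₀)*` as an
element of `E`. -/
def CRCplus (J₁ J₂ : Set ℕ) (fi : ℕ → E → ℝ) (b : ℕ → F) (w : ℕ → E)
    (x₀ : E) (V : Set E) : Prop :=
  J₂ ⊆ J₁ ∧ V ∈ 𝓝 x₀ ∧
  -- 1. `(Df_i(x))_{i∈J₂}` is a Schauder basis of the closed span of `(Df_i(x))_{i∈J₁}`
  (∀ x ∈ V, IsSchauderBasisOn J₂ (fun i => fderiv ℝ (fi i) x)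
      (((Submodule.span ℝ ((fun i => fderiv ℝ (fi i) x) '' J₁)).topologicalClosure :
        Submodule ℝ (E →L[ℝ] ℝ)) : Set (E →L[ℝ] ℝ))) ∧
  -- 2. for `x ∈ V`, `(Df_i(x))_{i∈J₂}` is equivalent (isomorphic via `z_x`) to `(Df_i(x₀))_{i∈J₂}`
  (∀ x ∈ V, ∀ a : ℕ → ℝ, (∀ n ∉ J₂, a n = 0) →
    ((∃ φ : E →L[ℝ] ℝ, ConvergesOn J₂ a (fun i => fderiv ℝ (fi i) x) φ) ↔
     (∃ φ : E →L[ℝ] ℝ, ConvergesOn J₂ a (fun i => fderiv ℝ (fi i) x₀) φ))) ∧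
  -- 3. the image `(Df_i(x₀))_{i∈J₂}(E)` is closed in `Y(J₂)`
  IsClosed {y : F | ∃ e : E, ConvergesOn J₂ (fun i => fderiv ℝ (fi i) x₀ e) b y} ∧
  -- 4. `(Df_i(x₀))_{i∈J₂}` is a shrinking and boundedly-complete basis of the closed span
  ShrinkingOn J₁ J₂ (fun i => fderiv ℝ (fi i) x₀) ∧
  BoundedlyCompleteOn J₂ (fun i => fderiv ℝ (fi i) x₀) ∧
  -- 5. Besselian
  BesselianOn J₂ (fun i => fderiv ℝ (fi i) x₀) ∧
  -- 6. the biorthogonal functionals `Df_i(x₀)*` lie in `E`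
  (∀ i ∈ J₂, ∀ j ∈ J₂, fderiv ℝ (fi i) x₀ (w j) = if i = j then 1 else 0)

end CRC

open scoped RealInnerProductSpace

/-- A Caristi-type descent principle: if from every point `x ≠ a` of a complete metric space one can
move strictly while the displacement and the variation of `g` are controlled by the decrease of
`D ≥ 0`, then the variation of `g` between any `x` and `a` is controlled by the decrease of `D`. -/
theorem abs_sub_le_of_descent {X : Type*} [MetricSpace X] [CompleteSpace X] {D g : X → ℝ}
    (hD : Continuous D) (hD0 : ∀ x, 0 ≤ D x) (hg : Continuous g) {a : X}
    (hstep : ∀ x, x ≠ a → ∃ y, y ≠ x ∧ dist x y ≤ D x - D y ∧ |g x - g y| ≤ D x - D y) (x : X) :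
    |g x - g a| ≤ D x - D a := by
  let S : X → Set X := fun x => {y | dist x y ≤ D x - D y ∧ |g x - g y| ≤ D x - D y}
  have S_refl : ∀ x, x ∈ S x := fun x => by simp [S]
  have S_trans : ∀ {x y z}, y ∈ S x → z ∈ S y → z ∈ S x := by
    rintro x y z ⟨h1, h2⟩ ⟨h3, h4⟩
    exact ⟨by linarith [dist_triangle x y z], by linarith [abs_sub_le (g x) (g y) (g z)]⟩
  have S_closed : ∀ x, IsClosed (S x) := fun x => by
    have h1 : IsClosed {y | dist x y ≤ D x - D y} := isClosed_le (by fun_prop) (by fun_prop)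
    have h2 : IsClosed {y | |g x - g y| ≤ D x - D y} := isClosed_le (by fun_prop) (by fun_prop)
    exact h1.inter h2
  have hbdd : ∀ x, BddBelow (D '' S x) := fun x => ⟨0, by rintro _ ⟨y, -, rfl⟩; exact hD0 y⟩
  have hnext : ∀ (n : ℕ) (x : X), ∃ y ∈ S x, D y < sInf (D '' S x) + 1 / ((n : ℝ) + 1) := by
    intro n x
    obtain ⟨_, ⟨y, hy, rfl⟩, hlt⟩ := exists_lt_of_csInf_lt (Set.Nonempty.image D ⟨x, S_refl x⟩)
      (lt_add_of_pos_right (sInf (D '' S x)) (Nat.one_div_pos_of_nat (α := ℝ) (n := n)))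
    exact ⟨y, hy, hlt⟩
  choose next hnextS hnextD using hnext
  let u : ℕ → X := fun n => Nat.rec x next n
  have hu : ∀ n m, n ≤ m → u m ∈ S (u n) := by
    intro n m hnm
    induction m, hnm using Nat.le_induction with
    | base => exact S_refl _
    | succ m _ ih => exact S_trans ih (hnextS m (u m))
  have hanti : Antitone (D ∘ u) := fun n m hnm => by
    have := (hu n m hnm).1
    have := dist_nonneg (x := u n) (y := u m)
    simp only [Function.comp]; linarith
  have hconv := tendsto_atTop_ciInf hanti ⟨0, by rintro _ ⟨n, rfl⟩; exact hD0 _⟩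
  have hcauchy : CauchySeq u := by
    refine Metric.cauchySeq_iff'.2 fun ε hε => ?_
    obtain ⟨N, hN⟩ := Metric.cauchySeq_iff'.1 hconv.cauchySeq ε hε
    refine ⟨N, fun n hn => ?_⟩
    have h1 := hN n hn
    rw [dist_comm, Real.dist_eq] at h1
    have h2 := (hu N n hn).1
    rw [dist_comm]
    exact h2.trans_lt ((le_abs_self _).trans_lt h1)
  obtain ⟨z, hz⟩ := cauchySeq_tendsto_of_complete hcauchy
  have hzS : ∀ n, z ∈ S (u n) := fun n =>
    (S_closed _).mem_of_tendsto hz (eventually_atTop.2 ⟨n, hu n⟩)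
  suffices hza : z = a by
    have := (hzS 0).2
    rw [hza] at this
    exact this
  by_contra hne
  obtain ⟨y, hyz, hy⟩ := hstep z hne
  have hDy : ∀ n : ℕ, D z - 1 / ((n : ℝ) + 1) ≤ D y := fun n => by
    have h1 : sInf (D '' S (u n)) ≤ D y :=
      csInf_le (hbdd _) ⟨y, S_trans (hzS n) hy, rfl⟩
    have h2 : D (u (n + 1)) < sInf (D '' S (u n)) + 1 / ((n : ℝ) + 1) := hnextD n (u n)
    have h3 := (hzS (n + 1)).1
    have h4 := dist_nonneg (x := u (n + 1)) (y := z)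
    linarith
  have hlim : Tendsto (fun n : ℕ => D z - 1 / ((n : ℝ) + 1)) atTop (𝓝 (D z - 0)) :=
    tendsto_const_nhds.sub tendsto_one_div_add_atTop_nhds_zero_nat
  have := le_of_tendsto' hlim hDy
  have := hy.1
  have := dist_pos.2 hyz.symm
  linarith

section Submersion

variable {E L : Type*} [NormedAddCommGroup E] [NormedSpace ℝ E] [CompleteSpace E]
  [NormedAddCommGroup L] [NormedSpace ℝ L] [CompleteSpace L]

/-- Lyusternik's estimate: near a point where the strict derivative is onto, the distance to the
level set is controlled by the defect. -/
theorem HasStrictFDerivAt.exists_mem_level_norm_sub_le {Φ : E → L} {T : E →L[ℝ] L} {x₀ : E}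
    (hΦ : HasStrictFDerivAt Φ T x₀) (hT : Function.Surjective T) :
    ∃ C : ℝ, 0 < C ∧ ∀ᶠ z in 𝓝 x₀, ∃ y, Φ y = Φ x₀ ∧ ‖y - z‖ ≤ C * ‖Φ z - Φ x₀‖ := by
  have hr : T.range = ⊤ := LinearMap.range_eq_top.2 hT
  let R := T.nonlinearRightInverseOfSurjective hr
  have hR : 0 < R.nnnorm := T.nonlinearRightInverseOfSurjective_nnnorm_pos hr
  have hR' : (0 : ℝ) < R.nnnorm := hR
  obtain ⟨s, hs, happ⟩ := hΦ.approximates_deriv_on_nhds (c := R.nnnorm⁻¹ / 2)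
    (Or.inr (by positivity))
  obtain ⟨ρ, hρ, hρs⟩ := Metric.mem_nhds_iff.1 hs
  refine ⟨2 * R.nnnorm, by positivity, ?_⟩
  have hcont : Tendsto (fun z => ‖z - x₀‖ + 2 * R.nnnorm * ‖Φ z - Φ x₀‖) (𝓝 x₀) (𝓝 0) := by
    have h1 : ContinuousAt (fun z => ‖z - x₀‖ + 2 * R.nnnorm * ‖Φ z - Φ x₀‖) x₀ := by
      have := hΦ.continuousAt
      fun_prop
    simpa [ContinuousAt] using h1
  filter_upwards [hcont.eventually (gt_mem_nhds hρ)] with z hz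
  have hball : Metric.closedBall z (2 * R.nnnorm * ‖Φ z - Φ x₀‖) ⊆ s := by
    refine Subset.trans (fun y hy => ?_) hρs
    rw [Metric.mem_closedBall, dist_eq_norm] at hy
    rw [Metric.mem_ball, dist_eq_norm]
    linarith [norm_sub_le_norm_sub_add_norm_sub y z x₀]
  obtain ⟨y, hy, hyΦ⟩ := happ.surjOn_closedBall_of_nonlinearRightInverse R (by positivity) hball
    (show Φ x₀ ∈ _ by
      rw [Metric.mem_closedBall, dist_comm, dist_eq_norm]
      push_cast
      apply le_of_eq
      field_simp
      ring)
  exact ⟨y, hyΦ, by simpa [dist_eq_norm] using hy⟩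

/-- Near a point where `Φ` is a submersion, every function whose derivative factors through that of
`Φ` is constant on the level set of `Φ`; no complement of the kernel is needed. -/
theorem HasStrictFDerivAt.eventually_eq_of_fderiv_factors {Φ : E → L} {T : E →L[ℝ] L} {x₀ : E}
    (hΦ : HasStrictFDerivAt Φ T x₀) (hT : Function.Surjective T) (hΦd : Differentiable ℝ Φ)
    {U : Set E} (hU : U ∈ 𝓝 x₀) :
    ∀ᶠ x in 𝓝 x₀, Φ x = Φ x₀ → ∀ g : E → ℝ, Differentiable ℝ g →
      (∀ z ∈ U, ∃ μ : L →L[ℝ] ℝ, fderiv ℝ g z = μ.comp (fderiv ℝ Φ z)) → g x = g x₀ := by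
  obtain ⟨C, hC, hreg⟩ := hΦ.exists_mem_level_norm_sub_le hT
  obtain ⟨c, hc⟩ : ∃ c : NNReal, (c : ℝ) = 1 / (8 * C) := ⟨⟨_, by positivity⟩, rfl⟩
  obtain ⟨s, hs, happ⟩ := hΦ.approximates_deriv_on_nhds (c := c)
    (Or.inr (by rw [← NNReal.coe_pos, hc]; positivity))
  obtain ⟨r, hr, hrsub⟩ := Metric.nhds_basis_closedBall.mem_iff.1
    (inter_mem (inter_mem hU hs) hreg)
  have happ' : ∀ x ∈ Metric.closedBall x₀ r, ∀ y ∈ Metric.closedBall x₀ r,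
      ‖Φ x - Φ y - T (x - y)‖ ≤ 1 / (8 * C) * ‖x - y‖ := fun x hx y hy =>
    hc ▸ happ x (hrsub hx).1.2 y (hrsub hy).1.2
  filter_upwards [Metric.closedBall_mem_nhds x₀ hr] with x hx hxΦ g hg hfac
  let Q : Set E := Metric.closedBall x₀ r ∩ {z | Φ z = Φ x₀}
  have hQ : IsClosed Q :=
    Metric.isClosed_closedBall.inter (isClosed_eq hΦd.continuous continuous_const)
  have : CompleteSpace Q := hQ.completeSpace_coe
  -- one step of the descent towards `x₀`
  have hstep : ∀ ε : ℝ, 0 < ε → ∀ x ∈ Q, x ≠ x₀ → ∃ y ∈ Q, y ≠ x ∧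
      ‖x - y‖ ≤ 2 * ‖x - x₀‖ - 2 * ‖y - x₀‖ ∧ |g x - g y| ≤ ε * ‖x - y‖ := by
    rintro ε hε x ⟨hxr, hxΦ⟩ hne
    have hpos : 0 < ‖x - x₀‖ := norm_pos_iff.2 (sub_ne_zero.2 hne)
    obtain ⟨μ, hμ⟩ := hfac x (hrsub hxr).1.1
    have hder : HasFDerivAt (fun z => g z - μ (Φ z)) (0 : E →L[ℝ] ℝ) x := by
      have := (hg x).hasFDerivAt.sub (μ.hasFDerivAt.comp x (hΦd x).hasFDerivAt)
      rwa [hμ, sub_self] at this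
    have hsmall : ∀ᶠ z in 𝓝 x, |g z - μ (Φ z) - (g x - μ (Φ x))| ≤ ε * ‖z - x‖ := by
      have := hder.isLittleO.def hε
      simpa using this
    obtain ⟨δ, hδ, hδs⟩ := Metric.mem_nhds_iff.1 hsmall
    obtain ⟨h, h0, h1, hhδ⟩ : ∃ h : ℝ, 0 < h ∧ h < 1 ∧ 2 * h * ‖x - x₀‖ < δ := by
      refine ⟨min (1 / 2) (δ / (4 * ‖x - x₀‖)), by positivity,
        (min_le_left _ _).trans_lt (by norm_num), ?_⟩
      have : min (1 / 2) (δ / (4 * ‖x - x₀‖)) * (4 * ‖x - x₀‖) ≤ δ :=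
        (le_div_iff₀ (by positivity)).1 (min_le_right _ _)
      linarith
    set z := x - h • (x - x₀) with hz
    have hzx : x - z = h • (x - x₀) := by simp [hz]
    have hzx₀ : z - x₀ = (1 - h) • (x - x₀) := by rw [hz]; module
    have hnzx : ‖x - z‖ = h * ‖x - x₀‖ := by rw [hzx, norm_smul, Real.norm_of_nonneg h0.le]
    have hnzx₀ : ‖z - x₀‖ = (1 - h) * ‖x - x₀‖ := by
      rw [hzx₀, norm_smul, Real.norm_of_nonneg (by linarith)]
    have hxr' : ‖x - x₀‖ ≤ r := by simpa [dist_eq_norm] using hxr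
    have hzr : z ∈ Metric.closedBall x₀ r := by
      rw [Metric.mem_closedBall, dist_eq_norm, hnzx₀]; nlinarith
    have hdef : ‖Φ z - Φ x₀‖ ≤ 1 / (4 * C) * (h * ‖x - x₀‖) := by
      have e1 := happ' x hxr z hzr
      have e2 := happ' x hxr x₀ (Metric.mem_closedBall_self hr.le)
      rw [hxΦ, sub_self, zero_sub, norm_neg] at e2
      rw [hzx, map_smul] at e1
      have e3 : Φ z - Φ x₀ = -(Φ x - Φ z - h • T (x - x₀)) - h • T (x - x₀) := by
        rw [hxΦ]; abel
      rw [e3]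
      refine (norm_sub_le _ _).trans ?_
      rw [norm_neg, norm_smul h (T _), Real.norm_of_nonneg h0.le]
      rw [norm_smul, Real.norm_of_nonneg h0.le] at e1
      have e4 := mul_le_mul_of_nonneg_left e2 h0.le
      calc _ ≤ 1 / (8 * C) * (h * ‖x - x₀‖) + h * (1 / (8 * C) * ‖x - x₀‖) := add_le_add e1 e4
        _ = _ := by field_simp; ring
    obtain ⟨y, hyΦ, hyz⟩ := (hrsub hzr).2
    have hyz' : ‖y - z‖ ≤ h * ‖x - x₀‖ / 4 := by
      refine hyz.trans ((mul_le_mul_of_nonneg_left hdef hC.le).trans (le_of_eq ?_))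
      field_simp
    have hyx₀ : ‖y - x₀‖ ≤ ‖x - x₀‖ - 3 / 4 * (h * ‖x - x₀‖) := by
      linarith [norm_sub_le_norm_sub_add_norm_sub y z x₀]
    have hxy : ‖x - y‖ ≤ 5 / 4 * (h * ‖x - x₀‖) := by
      have := norm_sub_le_norm_sub_add_norm_sub x z y
      rw [norm_sub_rev z y] at this
      linarith
    have hhx : 0 < h * ‖x - x₀‖ := by positivity
    refine ⟨y, ⟨?_, hyΦ⟩, ?_, by linarith, ?_⟩
    · rw [Metric.mem_closedBall, dist_eq_norm]; linarith
    · rintro rfl; linarith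
    · have hyδ : y ∈ Metric.ball x δ := by
        rw [Metric.mem_ball, dist_comm, dist_eq_norm]; linarith
      have := hδs hyδ
      rw [mem_ofPred_eq, hyΦ, hxΦ, sub_sub_sub_cancel_right] at this
      rwa [abs_sub_comm, norm_sub_rev x y]
  have hQx₀ : x₀ ∈ Q := ⟨Metric.mem_closedBall_self hr.le, rfl⟩
  have hbound : ∀ ε : ℝ, 0 < ε → |g x - g x₀| ≤ ε * (2 * ‖x - x₀‖) := by
    intro ε hε
    have key := abs_sub_le_of_descent (X := Q) (D := fun z => 2 * ‖(z : E) - x₀‖)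
      (g := fun z => ε⁻¹ * g z) (a := ⟨x₀, hQx₀⟩) (by fun_prop) (fun z => by positivity)
      (continuous_const.mul (hg.continuous.comp continuous_subtype_val))
      (by
        rintro ⟨z, hz⟩ hzne
        obtain ⟨y, hyQ, hyne, h1, h2⟩ := hstep ε hε z hz (fun h => hzne (Subtype.ext h))
        refine ⟨⟨y, hyQ⟩, fun h => hyne (congrArg Subtype.val h), ?_, ?_⟩
        · simpa [Subtype.dist_eq, dist_eq_norm] using h1
        · simp only
          rw [← mul_sub, abs_mul, _root_.abs_of_pos (_root_.inv_pos.2 hε), inv_mul_le_iff₀ hε]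
          exact h2.trans (mul_le_mul_of_nonneg_left h1 hε.le)) ⟨x, hx, hxΦ⟩
    simp only [sub_self, norm_zero, mul_zero, sub_zero] at key
    rwa [← mul_sub, abs_mul, _root_.abs_of_pos (_root_.inv_pos.2 hε), inv_mul_le_iff₀ hε] at key
  have hlim : Tendsto (fun ε : ℝ => ε * (2 * ‖x - x₀‖)) (𝓝[>] 0) (𝓝 (0 * (2 * ‖x - x₀‖))) :=
    (tendsto_id.mul_const _).mono_left nhdsWithin_le_nhds
  have := ge_of_tendsto hlim (eventually_mem_nhdsWithin.mono fun ε hε => hbound ε hε)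
  rw [zero_mul] at this
  exact sub_eq_zero.1 (abs_nonpos_iff.1 this)

/-- **Lyusternik's theorem**: the kernel of a surjective strict derivative is tangent to the level
set. -/
theorem HasStrictFDerivAt.mem_posTangentConeAt_level {Φ : E → L} {T : E →L[ℝ] L} {x₀ : E}
    (hΦ : HasStrictFDerivAt Φ T x₀) (hT : Function.Surjective T) {d : E} (hd : T d = 0) :
    d ∈ posTangentConeAt {x | Φ x = Φ x₀} x₀ := by
  obtain ⟨C, hC, hreg⟩ := hΦ.exists_mem_level_norm_sub_le hT
  have hlim : Tendsto (fun t : NNReal => x₀ + (t : ℝ) • d) (𝓝[>] 0) (𝓝 x₀) := by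
    have : Continuous (fun t : NNReal => x₀ + (t : ℝ) • d) := by fun_prop
    simpa using (this.tendsto 0).mono_left nhdsWithin_le_nhds
  have hex : ∀ t : NNReal, ∃ y, (∃ y, Φ y = Φ x₀ ∧
      ‖y - (x₀ + (t : ℝ) • d)‖ ≤ C * ‖Φ (x₀ + (t : ℝ) • d) - Φ x₀‖) →
      Φ y = Φ x₀ ∧ ‖y - (x₀ + (t : ℝ) • d)‖ ≤ C * ‖Φ (x₀ + (t : ℝ) • d) - Φ x₀‖ := fun t => by
    by_cases h : ∃ y, Φ y = Φ x₀ ∧ ‖y - (x₀ + (t : ℝ) • d)‖ ≤ C * ‖Φ (x₀ + (t : ℝ) • d) - Φ x₀‖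
    · exact h.imp fun y hy _ => hy
    · exact ⟨x₀, fun h' => absurd h' h⟩
  choose y hy using hex
  have hy' := (hlim.eventually hreg).mono fun t ht => hy t ht
  have hsmall : Tendsto (fun t : NNReal => (t : ℝ)⁻¹ • (y t - x₀) - d) (𝓝[>] 0) (𝓝 0) := by
    rw [Metric.tendsto_nhds]
    intro ε hε
    have hder := (hΦ.hasFDerivAt.isLittleO.def
      (show 0 < ε / (2 * C * (‖d‖ + 1)) by positivity))
    filter_upwards [hlim.eventually hder, hy', self_mem_nhdsWithin] with t h1 h2 ht
    have ht' : (0 : ℝ) < t := ht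
    rw [add_sub_cancel_left, map_smul, hd, smul_zero, sub_zero, norm_smul,
      Real.norm_of_nonneg ht'.le] at h1
    have h3 : (t : ℝ)⁻¹ • (y t - x₀) - d = (t : ℝ)⁻¹ • (y t - (x₀ + (t : ℝ) • d)) := by
      rw [← sub_sub, smul_sub _ (y t - x₀), inv_smul_smul₀ ht'.ne']
    rw [dist_zero_right, h3, norm_smul, norm_inv, Real.norm_of_nonneg ht'.le,
      inv_mul_lt_iff₀ ht']
    calc _ ≤ C * (ε / (2 * C * (‖d‖ + 1)) * (t * ‖d‖)) :=
          h2.2.trans (mul_le_mul_of_nonneg_left h1 hC.le)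
      _ = t * ε * (‖d‖ / (‖d‖ + 1)) / 2 := by field_simp
      _ ≤ t * ε * 1 / 2 := by
          gcongr
          exact (div_le_one (by positivity)).2 (by linarith)
      _ < t * ε := by have := mul_pos ht' hε; linarith
  have hcd : Tendsto (fun t : NNReal => (t : ℝ)⁻¹ • (y t - x₀)) (𝓝[>] 0) (𝓝 d) := by
    simpa using hsmall.add_const d
  refine mem_tangentConeAt_of_seq (𝓝[>] (0 : NNReal)) (fun t => t⁻¹) (fun t => y t - x₀) ?_
    (hy'.mono fun t ht => by simpa using ht.1) (by simpa [NNReal.smul_def] using hcd)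
  have h0 : Tendsto (fun t : NNReal => (t : ℝ)) (𝓝[>] 0) (𝓝 0) := by
    simpa using (NNReal.continuous_coe.tendsto 0).mono_left nhdsWithin_le_nhds
  have := h0.smul hcd
  rw [zero_smul] at this
  refine this.congr' (eventually_mem_nhdsWithin.mono fun t ht => ?_)
  have ht' : (0 : ℝ) < t := ht
  rw [smul_inv_smul₀ ht'.ne']

/-- At a local minimum on a level set of a submersion, the derivative of the objective factors
through the derivative of the constraint. -/
theorem IsLocalMinOn.exists_comp_eq_of_hasStrictFDerivAt {Φ : E → L} {T : E →L[ℝ] L} {x₀ : E}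
    {f : E → ℝ} {f' : E →L[ℝ] ℝ} (hf : HasFDerivAt f f' x₀)
    (hmin : IsLocalMinOn f {x | Φ x = Φ x₀} x₀)
    (hΦ : HasStrictFDerivAt Φ T x₀) (hT : Function.Surjective T) :
    ∃ μ : L →L[ℝ] ℝ, f' = μ.comp T := by
  have hker : ∀ d, T d = 0 → f' d = 0 := fun d hd =>
    hmin.hasFDerivWithinAt_eq_zero hf.hasFDerivWithinAt (hΦ.mem_posTangentConeAt_level hT hd)
      (hΦ.mem_posTangentConeAt_level hT (by rw [map_neg, hd, neg_zero]))
  let R := T.nonlinearRightInverseOfSurjective (LinearMap.range_eq_top.2 hT)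
  have hR : ∀ y, T (R y) = y := R.right_inv
  have key : ∀ e y, T e = y → f' (R y) = f' e := fun e y h => by
    rw [← sub_eq_zero, ← map_sub]
    exact hker _ (by rw [map_sub, hR, h, sub_self])
  let μ : L →ₗ[ℝ] ℝ :=
    { toFun := fun y => f' (R y)
      map_add' := fun y z => by
        rw [← map_add]
        exact key _ _ (by rw [map_add, hR, hR])
      map_smul' := fun c y => by
        rw [RingHom.id_apply, ← map_smul]
        exact key _ _ (by rw [map_smul, hR]) }
  refine ⟨μ.mkContinuous (‖f'‖ * R.nnnorm) fun y => ?_, ?_⟩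
  · refine (f'.le_opNorm _).trans ?_
    rw [mul_assoc]
    exact mul_le_mul_of_nonneg_left (R.bound y) (norm_nonneg _)
  · ext e
    exact (key e _ rfl).symm

end Submersion

section SquareSummable

theorem convergesOn_of_hasSum {X : Type*} [NormedAddCommGroup X] [NormedSpace ℝ X] {J : Set ℕ}
    {a : ℕ → ℝ} {v : ℕ → X} {x : X} (h : HasSum (fun j : J => a j • v j) x) :
    ConvergesOn J a v x := by
  classical
  have hlim : Tendsto (fun N => (Finset.range N).subtype (· ∈ J)) atTop atTop := by
    refine tendsto_atTop_finset_of_monotone (fun N M hNM j hj => ?_) fun j => ⟨j + 1, by simp⟩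
    simp only [Finset.mem_subtype, Finset.mem_range] at hj ⊢
    omega
  refine (Tendsto.comp h hlim).congr fun N => ?_
  simp only [Function.comp, partialSumOn]
  rw [Finset.sum_subtype_eq_sum_filter (f := fun n => a n • v n), Finset.sum_filter]
  exact Finset.sum_congr rfl fun n _ => by by_cases hn : n ∈ J <;> simp [hn]

theorem memℓp_two_of_summable_sq {J : Set ℕ} {a : ℕ → ℝ} (h : Summable fun n => a n ^ 2) :
    Memℓp (fun j : J => a j) 2 := by
  have hJ : Summable fun j : J => a j ^ 2 := h.comp_injective Subtype.val_injective
  exact memℓp_gen (by simpa using hJ)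

/-- The pullback under `T` of the functional represented by `a ∈ ℓ²` is the norm-convergent
combination of the coordinate functionals of `T` with coefficients `a`. -/
theorem convergesOn_innerSL_comp {E : Type*} [NormedAddCommGroup E] [NormedSpace ℝ E] {J : Set ℕ}
    (T : E →L[ℝ] lp (fun _ : J => ℝ) 2) {φ : ℕ → E →L[ℝ] ℝ} (hφ : ∀ (j : J) e, φ j e = T e j)
    (a : lp (fun _ : J => ℝ) 2) {a' : ℕ → ℝ} (ha' : ∀ j : J, a' j = a j) :
    ConvergesOn J a' φ ((innerSL ℝ a).comp T) := by
  classical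
  refine convergesOn_of_hasSum ?_
  have h1 := lp.hasSum_single (p := 2) (by simp) a
  have h2 := h1.mapL (((ContinuousLinearMap.compL ℝ E _ ℝ).flip T).comp (innerSL ℝ))
  have h3 : (fun j : J => a' j • φ j) = fun j => (((ContinuousLinearMap.compL ℝ E _ ℝ).flip T).comp
      (innerSL ℝ)) (lp.single 2 j (a j)) := by
    funext j
    ext e
    simp [hφ, ha', lp.inner_single_left, mul_comm]
  rw [h3]
  exact h2

variable {H : Type*} [NormedAddCommGroup H] [NormedSpace ℝ H]

theorem apply_eq_of_convergesOn_univ {b : ℕ → H} {bs : ℕ → (H →L[ℝ] ℝ)}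
    (hbi : ∀ i j, bs i (b j) = if i = j then 1 else 0) {a : ℕ → ℝ} {x : H}
    (h : ConvergesOn Set.univ a b x) (n : ℕ) : bs n x = a n := by
  refine tendsto_nhds_unique (((bs n).continuous.tendsto x).comp h) ?_
  refine tendsto_const_nhds.congr' (eventually_atTop.2 ⟨n + 1, fun N hN => ?_⟩)
  have hn : n < N := hN
  simp [partialSumOn, hbi, hn]

theorem convergesOn_univ_of_expansion {b : ℕ → H} {bs : ℕ → (H →L[ℝ] ℝ)}
    (hexp : ∀ y : H, Tendsto (fun N => ∑ n ∈ Finset.range N, bs n y • b n) atTop (𝓝 y)) (y : H) :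
    ConvergesOn Set.univ (fun n => bs n y) b y :=
  (hexp y).congr fun N => by simp [partialSumOn]

variable [CompleteSpace H]

/-- The coordinates of a Besselian basis define a bounded operator into `ℓ²`. -/
theorem BesselianOn.exists_coordinate_map {b : ℕ → H} {bs : ℕ → (H →L[ℝ] ℝ)}
    (hb : BesselianOn Set.univ b)
    (hexp : ∀ y : H, Tendsto (fun N => ∑ n ∈ Finset.range N, bs n y • b n) atTop (𝓝 y))
    (J : Set ℕ) : ∃ A : H →L[ℝ] lp (fun _ : J => ℝ) 2, ∀ y (j : J), A y j = bs j y := by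
  have hmem : ∀ y, Memℓp (fun j : J => bs j y) 2 := fun y =>
    memℓp_two_of_summable_sq (a := fun n => bs n y) (hb (fun n => bs n y) (by simp)
      ⟨y, convergesOn_univ_of_expansion hexp y⟩)
  have hex : ∀ y, ∃ c : lp (fun _ : J => ℝ) 2, ∀ j : J, c j = bs j y := fun y =>
    ⟨⟨_, hmem y⟩, fun _ => rfl⟩
  choose A hA using hex
  let A' : H →ₗ[ℝ] lp (fun _ : J => ℝ) 2 :=
    { toFun := A
      map_add' := fun y z => by ext j; simp [hA]
      map_smul' := fun c y => by ext j; simp [hA] }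
  refine ⟨ContinuousLinearMap.ofSeqClosedGraph (g := A') fun u x y hu hAu => ?_,
    fun y j => by simp [A', hA]⟩
  ext j
  refine tendsto_nhds_unique
    (((lp.evalCLM ℝ (fun _ : J => ℝ) 2 j).continuous.tendsto y).comp hAu) ?_
  have hlim := ((bs j).continuous.tendsto x).comp hu
  rw [show bs j x = A' x j from (hA x j).symm] at hlim
  exact hlim.congr fun k => (hA (u k) j).symm

/-- A Hilbertian basis defines a bounded synthesis operator on `ℓ²`. -/
theorem HilbertianOn.exists_synthesis_map {b : ℕ → H} {bs : ℕ → (H →L[ℝ] ℝ)}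
    (hb : HilbertianOn Set.univ b) (hbi : ∀ i j, bs i (b j) = if i = j then 1 else 0)
    (hexp : ∀ y : H, Tendsto (fun N => ∑ n ∈ Finset.range N, bs n y • b n) atTop (𝓝 y))
    (J : Set ℕ) : ∃ B : lp (fun _ : J => ℝ) 2 →L[ℝ] H,
      (∀ c (j : J), bs j (B c) = c j) ∧ ∀ c, ∀ n ∉ J, bs n (B c) = 0 := by
  classical
  have hext : ∀ y z : H, (∀ n, bs n y = bs n z) → y = z := fun y z h =>
    tendsto_nhds_unique (hexp y) ((hexp z).congr fun N => by simp [h])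
  have hex : ∀ c : lp (fun _ : J => ℝ) 2, ∃ y : H,
      ∀ n, bs n y = if h : n ∈ J then c ⟨n, h⟩ else 0 := fun c => by
    have hsum : Summable fun j : J => c j ^ 2 := by
      simpa using (memℓp_gen_iff (p := 2) (by simp)).1 (lp.memℓp c)
    obtain ⟨y, hy⟩ := hb (fun n => if h : n ∈ J then c ⟨n, h⟩ else 0) (by simp) (by
      refine (Function.Injective.summable_iff (f := fun n : ℕ =>
        (if h : n ∈ J then c ⟨n, h⟩ else 0) ^ 2) (Subtype.val_injective (p := (· ∈ J)))
        fun n hn => ?_).1 ?_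
      · have : n ∉ J := fun h => hn ⟨⟨n, h⟩, rfl⟩
        simp [this]
      · refine hsum.congr fun j => ?_
        simp)
    exact ⟨y, apply_eq_of_convergesOn_univ hbi hy⟩
  choose B hB using hex
  let B' : lp (fun _ : J => ℝ) 2 →ₗ[ℝ] H :=
    { toFun := B
      map_add' := fun c d => hext _ _ fun n => by
        by_cases h : n ∈ J <;> simp [hB, h]
      map_smul' := fun r c => hext _ _ fun n => by
        by_cases h : n ∈ J <;> simp [hB, h] }
  refine ⟨ContinuousLinearMap.ofSeqClosedGraph (g := B') fun u x y hu hBu => hext _ _ fun n => ?_,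
    fun c j => by simp [B', hB], fun c n hn => by simp [B', hB, hn]⟩
  refine tendsto_nhds_unique (((bs n).continuous.tendsto y).comp hBu) ?_
  by_cases h : n ∈ J
  · refine (((lp.evalCLM ℝ (fun _ : J => ℝ) 2 ⟨n, h⟩).continuous.tendsto x).comp hu).congr'
      (Eventually.of_forall fun k => ?_) |>.trans (le_of_eq ?_)
    · simp [B', hB, h]; rfl
    · simp [B', hB, h]; rfl
  · simp [B', hB, h, Function.comp_def]

end SquareSummable

/-- A bounded operator into `ℓ²` with closed range whose coordinate functionals have at most one
expansion of zero is onto. -/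
theorem surjective_of_isClosed_range_of_unique_expansion {E : Type*} [NormedAddCommGroup E]
    [NormedSpace ℝ E] {J : Set ℕ} (T : E →L[ℝ] lp (fun _ : J => ℝ) 2) (hT : IsClosed (Set.range T))
    {φ : ℕ → E →L[ℝ] ℝ} (hφ : ∀ (j : J) e, φ j e = T e j)
    (huniq : ∀ a : ℕ → ℝ, (∀ n ∉ J, a n = 0) → ConvergesOn J a φ 0 → a = 0) :
    Function.Surjective T := by
  classical
  have hcl : IsClosed (T.range : Set (lp (fun _ : J => ℝ) 2)) := by
    rw [LinearMap.coe_range]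
    exact hT
  have : CompleteSpace T.range := hcl.completeSpace_coe
  refine LinearMap.range_eq_top.1 (Submodule.orthogonal_eq_bot_iff.1 ?_)
  refine (Submodule.eq_bot_iff _).2 fun a ha => ?_
  have h0 : (innerSL ℝ a).comp T = 0 := by
    ext e
    simpa [real_inner_comm] using ha (T e) ⟨e, rfl⟩
  have hconv := convergesOn_innerSL_comp T hφ a
    (a' := fun n => if h : n ∈ J then a ⟨n, h⟩ else 0) (fun j => by simp)
  rw [h0] at hconv
  have := huniq _ (fun n hn => by simp [hn]) hconv
  ext j
  simpa using congrFun this j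

theorem stmt19 {E H : Type*} [NormedAddCommGroup E] [NormedSpace ℝ E] [CompleteSpace E]
    [NormedAddCommGroup H] [InnerProductSpace ℝ H] [CompleteSpace H]
    (b : ℕ → H) (hb : IsSchauderBasis b)
    (hbBess : BesselianOn Set.univ b) (hbHilb : HilbertianOn Set.univ b)
    (bs : ℕ → (H →L[ℝ] ℝ))
    (hbi : ∀ i j, bs i (b j) = if i = j then 1 else 0)
    (hexp : ∀ y : H, Tendsto (fun N => ∑ n ∈ Finset.range N, bs n y • b n) atTop (𝓝 y))
    (G : E → H) (hG : ContDiff ℝ 1 G)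
    (I₀ : Set ℕ) (x₀ : E)
    (hfeas : x₀ ∈ {x : E | ∀ i ∈ I₀, bs i (G x) = 0})
    (f₀ : E → ℝ) (hf₀ : DifferentiableAt ℝ f₀ x₀)
    (hmin : IsLocalMinOn f₀ {x : E | ∀ i ∈ I₀, bs i (G x) = 0} x₀)
    -- CRC+ holds for `(g_i)_{i∈I₀}`, `g_i = b_i* ∘ G`, at `x₀`
    (J₂ : Set ℕ) (V : Set E) (w : ℕ → E)
    (hcrc : CRCplus I₀ J₂ (fun i x => bs i (G x)) b w x₀ V) :
    -- existence of a Lagrange multiplier `λ ∈ F ≅ F*`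
    ∃ lam : H, ∀ e : E, fderiv ℝ f₀ x₀ e = ⟪lam, fderiv ℝ G x₀ e⟫ := by
  obtain ⟨hJ, hV, hbasis, hequiv, hclosed, -, -, hBess, -⟩ := hcrc
  obtain ⟨A, hA⟩ := hbBess.exists_coordinate_map hexp J₂
  obtain ⟨B, hB, hB0⟩ := hbHilb.exists_synthesis_map hbi hexp J₂
  have hGd : Differentiable ℝ G := hG.differentiable (by norm_num)
  have hfd : ∀ i x, fderiv ℝ (fun x => bs i (G x)) x = (bs i).comp (fderiv ℝ G x) := fun i x =>
    ((bs i).hasFDerivAt.comp x (hGd x).hasFDerivAt).fderiv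
  have hcoord : ∀ x (j : J₂) e,
      fderiv ℝ (fun x => bs j (G x)) x e = (A.comp (fderiv ℝ G x)) e j := fun x j e => by
    rw [hfd]; simp [hA]
  let Φ : E → lp (fun _ : J₂ => ℝ) 2 := fun x => A (G x)
  have hΦd : ∀ x, HasFDerivAt Φ (A.comp (fderiv ℝ G x)) x := fun x =>
    A.hasFDerivAt.comp x (hGd x).hasFDerivAt
  have hΦ : HasStrictFDerivAt Φ (A.comp (fderiv ℝ G x₀)) x₀ :=
    A.hasStrictFDerivAt.comp x₀ (hG.contDiffAt.hasStrictFDerivAt (by norm_num))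
  have hx₀V : x₀ ∈ V := mem_of_mem_nhds hV
  have hrange : IsClosed (Set.range (A.comp (fderiv ℝ G x₀))) := by
    convert hclosed.preimage B.continuous using 1
    ext c
    constructor
    · rintro ⟨e, rfl⟩
      refine ⟨e, ?_⟩
      refine (convergesOn_univ_of_expansion hexp _).congr fun N => ?_
      refine Finset.sum_congr rfl fun n _ => ?_
      by_cases hn : n ∈ J₂
      · have h1 := hB (A.comp (fderiv ℝ G x₀) e) ⟨n, hn⟩
        simp only [indicator_univ, indicator_of_mem hn]
        rw [h1, hcoord x₀ ⟨n, hn⟩]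
      · simp [hn, hB0]
    · rintro ⟨e, he⟩
      refine ⟨e, ?_⟩
      have he' : ConvergesOn Set.univ
          (J₂.indicator fun i => fderiv ℝ (fun x => bs i (G x)) x₀ e) b (B c) :=
        he.congr fun N => by simp [partialSumOn]
      ext j
      rw [← hcoord, ← hB c j, apply_eq_of_convergesOn_univ hbi he', indicator_of_mem j.2]
  have hsurj : Function.Surjective (A.comp (fderiv ℝ G x₀)) :=
    surjective_of_isClosed_range_of_unique_expansion _ hrange (hcoord x₀) fun a ha hconv =>
      (hbasis x₀ hx₀V 0 (Submodule.zero_mem _)).unique ⟨ha, hconv⟩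
        ⟨fun _ _ => rfl, tendsto_const_nhds.congr fun N => by simp [partialSumOn]⟩
  have hfac : ∀ i ∈ I₀, ∀ x ∈ V, ∃ μ : lp (fun _ : J₂ => ℝ) 2 →L[ℝ] ℝ,
      fderiv ℝ (fun x => bs i (G x)) x = μ.comp (fderiv ℝ Φ x) := by
    intro i hi x hx
    obtain ⟨a, ⟨ha, hconv⟩, -⟩ := hbasis x hx (fderiv ℝ (fun x => bs i (G x)) x)
      (Submodule.le_topologicalClosure _ (Submodule.subset_span ⟨i, hi, rfl⟩))
    have hmem := memℓp_two_of_summable_sq (J := J₂) (hBess a ha ((hequiv x hx a ha).1 ⟨_, hconv⟩))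
    refine ⟨innerSL ℝ (⟨_, hmem⟩ : lp (fun _ : J₂ => ℝ) 2), ?_⟩
    rw [(hΦd x).fderiv]
    exact tendsto_nhds_unique hconv (convergesOn_innerSL_comp _ (hcoord x) _ fun j => rfl)
  have hΦx₀ : Φ x₀ = 0 := by
    ext j
    simpa [Φ, hA] using hfeas j (hJ j.2)
  have hlevel := hΦ.eventually_eq_of_fderiv_factors hsurj (fun x => (hΦd x).differentiableAt) hV
  have hmin' : IsLocalMinOn f₀ {x | Φ x = Φ x₀} x₀ := by
    refine hmin.filter_mono (le_inf nhdsWithin_le_nhds (le_principal_iff.2 ?_))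
    filter_upwards [nhdsWithin_le_nhds hlevel, self_mem_nhdsWithin] with x hx hxΦ i hi
    have := hx hxΦ (fun x => bs i (G x)) ((bs i).differentiable.comp hGd) (hfac i hi)
    exact this.trans (hfeas i hi)
  obtain ⟨μ, hμ⟩ := hmin'.exists_comp_eq_of_hasStrictFDerivAt hf₀.hasFDerivAt hΦ hsurj
  refine ⟨(InnerProductSpace.toDual ℝ H).symm (μ.comp A), fun e => ?_⟩
  rw [InnerProductSpace.toDual_symm_apply, hμ]
  rfl
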